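/- arXiv:2108.07748 — 4 statements merged into one kernel-verified Lean document; each statement's English description precedes it below -/
import Mathlib

section
/- Let C be a nonempty subset of ℝ^n. The following are equivalent: (1) C is an alcoved polyhedron, i.e., C = {x ∈ ℝ^n : x_i ≥ M_ij + x_j for all i,j} for some n×n matrix M with entries in ℝ ∪ {−∞}; (2) C is both a closed tropical cone and a closed dual tropical cone; (3) C is a closed ambitropical cone in which the least upper bound and greatest lower bound operations coincide with the componentwise max and min of ℝ^n; (4) there is a tropically linear Shapley operator T : ℝ^n → ℝ^n (i.e., a Shapley operator with T(x ∨ y) = T(x) ∨ T(y) for all x, y) such that C = {x : T(x) ≤ x}; (5) there is a dually tropically linear Shapley operator T (i.e., T(x ∧ y) = T(x) ∧ T(y)) such that C = {x : T(x) ≥ x}. -/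
open Set Filter Topology

namespace Ambitropical

variable {n : ℕ}

/-- An additive cone of `ℝ^n`: a set stable by the addition of a real constant
to every coordinate. -/
def AdditiveCone (C : Set (Fin n → ℝ)) : Prop :=
  ∀ x ∈ C, ∀ l : ℝ, (fun i => l + x i) ∈ C

/-- `z` is the least upper bound, *within* `C`, of the subset `X`. -/
def IsLubWithin (C X : Set (Fin n → ℝ)) (z : Fin n → ℝ) : Prop :=
  z ∈ C ∧ (∀ x ∈ X, x ≤ z) ∧ ∀ w ∈ C, (∀ x ∈ X, x ≤ w) → z ≤ w

/-- `z` is the greatest lower bound, *within* `C`, of the subset `X`. -/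
def IsGlbWithin (C X : Set (Fin n → ℝ)) (z : Fin n → ℝ) : Prop :=
  z ∈ C ∧ (∀ x ∈ X, z ≤ x) ∧ ∀ w ∈ C, (∀ x ∈ X, w ≤ x) → w ≤ z

/-- An ambitropical cone: a nonempty additive cone of `ℝ^n` that is a lattice in
the induced (componentwise) partial order. -/
def IsAmbitropicalCone (C : Set (Fin n → ℝ)) : Prop :=
  C.Nonempty ∧ AdditiveCone C ∧
    ∀ x ∈ C, ∀ y ∈ C, (∃ z, IsLubWithin C {x, y} z) ∧ ∃ z, IsGlbWithin C {x, y} z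

/-- A (abstract) Shapley operator: order preserving and commuting with the
addition of a constant. -/
def IsShapley {n p : ℕ} (T : (Fin n → ℝ) → (Fin p → ℝ)) : Prop :=
  Monotone T ∧ ∀ (l : ℝ) (x : Fin n → ℝ), T (fun i => l + x i) = fun i => l + T x i

/-- `E^max`: the set of componentwise suprema of bounded-above families
`(λ_f + f)_{f ∈ E}` with `λ_f ∈ ℝ ∪ {-∞}`, not all `-∞` (the subfamily with
finite coefficients is encoded by a nonempty subset `S` of `E`). -/
def MaxGen (E : Set (Fin n → ℝ)) : Set (Fin n → ℝ) :=
  {x | ∃ S : Set (Fin n → ℝ), S ⊆ E ∧ S.Nonempty ∧ ∃ lam : (Fin n → ℝ) → ℝ,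
      (∃ u : Fin n → ℝ, ∀ f ∈ S, (fun i => lam f + f i) ≤ u) ∧
      ∀ i, IsLUB {v : ℝ | ∃ f ∈ S, v = lam f + f i} (x i)}

/-- `E^min`: the set of componentwise infima of bounded-below families
`(μ_f + f)_{f ∈ E}` with `μ_f ∈ ℝ ∪ {+∞}`, not all `+∞`. -/
def MinGen (E : Set (Fin n → ℝ)) : Set (Fin n → ℝ) :=
  {x | ∃ S : Set (Fin n → ℝ), S ⊆ E ∧ S.Nonempty ∧ ∃ mu : (Fin n → ℝ) → ℝ,
      (∃ u : Fin n → ℝ, ∀ f ∈ S, u ≤ (fun i => mu f + f i)) ∧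
      ∀ i, IsGLB {v : ℝ | ∃ f ∈ S, v = mu f + f i} (x i)}

/-- `P` is the tropical projection `P^max_E`, i.e. `P z = sup {y ∈ E^max ∣ y ≤ z}`. -/
def IsPmaxMap (E : Set (Fin n → ℝ)) (P : (Fin n → ℝ) → Fin n → ℝ) : Prop :=
  ∀ z, IsLUB {y | y ∈ MaxGen E ∧ y ≤ z} (P z)

/-- `P` is the dual tropical projection `P^min_E`, i.e. `P z = inf {y ∈ E^min ∣ z ≤ y}`. -/
def IsPminMap (E : Set (Fin n → ℝ)) (P : (Fin n → ℝ) → Fin n → ℝ) : Prop :=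
  ∀ z, IsGLB {y | y ∈ MinGen E ∧ z ≤ y} (P z)

/-- `Q` is the canonical retraction `Q_C^-`, i.e. `Q x = sup^C {y ∈ C ∣ y ≤ x}`. -/
def IsQminusMap (C : Set (Fin n → ℝ)) (Q : (Fin n → ℝ) → Fin n → ℝ) : Prop :=
  ∀ x, IsLubWithin C {y ∈ C | y ≤ x} (Q x)

/-- `Q` is the canonical retraction `Q_C^+`, i.e. `Q x = inf^C {y ∈ C ∣ x ≤ y}`. -/
def IsQplusMap (C : Set (Fin n → ℝ)) (Q : (Fin n → ℝ) → Fin n → ℝ) : Prop :=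
  ∀ x, IsGlbWithin C {y ∈ C | x ≤ y} (Q x)

/-- A tropical cone: an additive cone stable by componentwise max. -/
def TropicalCone (C : Set (Fin n → ℝ)) : Prop :=
  AdditiveCone C ∧ ∀ x ∈ C, ∀ y ∈ C, x ⊔ y ∈ C

/-- A dual tropical cone: an additive cone stable by componentwise min. -/
def DualTropicalCone (C : Set (Fin n → ℝ)) : Prop :=
  AdditiveCone C ∧ ∀ x ∈ C, ∀ y ∈ C, x ⊓ y ∈ C

/-- `t(u) = max_i u_i`. -/
noncomputable def tmax (u : Fin n → ℝ) : ℝ := ⨆ i, u i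

/-- `b(u) = min_i u_i`. -/
noncomputable def bmin (u : Fin n → ℝ) : ℝ := ⨅ i, u i

/-- An alcoved polyhedron: a set of the form
`{x ∣ x_i ≥ M_ij + x_j}` with `M_ij ∈ ℝ ∪ {-∞}` (constraints with `M_ij = -∞`
are vacuous, as `⊥ + x_j = ⊥` in `WithBot ℝ`). -/
def IsAlcoved (C : Set (Fin n → ℝ)) : Prop :=
  ∃ M : Fin n → Fin n → WithBot ℝ,
    C = {x | ∀ i j, M i j + (x j : WithBot ℝ) ≤ (x i : WithBot ℝ)}

/-- A homogeneous subset of `ℝ^n`: stable by multiplication by positive scalars. -/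
def HomogeneousSet (C : Set (Fin n → ℝ)) : Prop :=
  ∀ α : ℝ, 0 < α → ∀ x ∈ C, α • x ∈ C

/-- A (positively) homogeneous operator. -/
def HomogeneousMap (T : (Fin n → ℝ) → Fin n → ℝ) : Prop :=
  ∀ α : ℝ, 0 < α → ∀ x : Fin n → ℝ, T (α • x) = α • T x

/-- A finitely generated Shapley operator `T = A^♯ ∘ B` for a proper pair of
matrices `A, B` with entries in `ℝ ∪ {-∞}`:
`T_i(x) = min_{j : A_{ji} ≠ -∞} ( -A_{ji} + max_{k : B_{jk} ≠ -∞} (B_{jk} + x_k) )`. -/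
def FgShapley {n : ℕ} (T : (Fin n → ℝ) → Fin n → ℝ) : Prop :=
  ∃ (m : ℕ) (A B : Fin m → Fin n → WithBot ℝ),
    (∀ i : Fin n, ∃ j : Fin m, A j i ≠ ⊥) ∧
    (∀ j : Fin m, ∃ k : Fin n, B j k ≠ ⊥) ∧
    ∀ (x : Fin n → ℝ) (i : Fin n),
      T x i = sInf {v : ℝ | ∃ (j : Fin m) (a : ℝ), A j i = (a : WithBot ℝ) ∧
        v = -a + sSup {w : ℝ | ∃ (k : Fin n) (b : ℝ), B j k = (b : WithBot ℝ) ∧ w = b + x k}}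

theorem alcoved_iff (C : Set (Fin n → ℝ)) : IsAlcoved C ↔
    ∃ (R : Fin n → Fin n → Prop) (A : Fin n → Fin n → ℝ),
      C = {x | ∀ i j, R i j → A i j + x j ≤ x i} := by
  classical
  constructor
  · rintro ⟨M, rfl⟩
    refine ⟨fun i j => M i j ≠ ⊥, fun i j => (M i j).unbotD 0, ?_⟩
    ext x
    simp only [mem_ofPred_eq]
    refine forall_congr' fun i => forall_congr' fun j => ?_
    induction h : M i j with
    | bot => simp
    | coe a =>
      simp only [WithBot.unbotD_coe, ne_eq, WithBot.coe_ne_bot, not_false_eq_true, true_implies]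
      exact_mod_cast Iff.rfl
  · rintro ⟨R, A, rfl⟩
    refine ⟨fun i j => if R i j then (A i j : WithBot ℝ) else ⊥, ?_⟩
    ext x
    simp only [mem_ofPred_eq]
    refine forall_congr' fun i => forall_congr' fun j => ?_
    by_cases h : R i j
    · simp only [h, true_implies, if_true]
      exact_mod_cast Iff.rfl
    · simp [h]

theorem alcoved_to_two (C : Set (Fin n → ℝ)) (h : IsAlcoved C) :
    TropicalCone C ∧ DualTropicalCone C ∧ IsClosed C := by
  obtain ⟨R, A, rfl⟩ := (alcoved_iff C).1 h
  have hadd : AdditiveCone {x : Fin n → ℝ | ∀ i j, R i j → A i j + x j ≤ x i} := by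
    intro x hx l i j hij
    have := hx i j hij
    show A i j + (l + x j) ≤ l + x i
    linarith
  refine ⟨⟨hadd, ?_⟩, ⟨hadd, ?_⟩, ?_⟩
  · intro x hx y hy i j hij
    have h1 := hx i j hij
    have h2 := hy i j hij
    simp only [Pi.sup_apply]
    rcases le_total (x j) (y j) with h | h
    · rw [sup_eq_right.2 h]; exact le_sup_of_le_right h2
    · rw [sup_eq_left.2 h]; exact le_sup_of_le_left h1
  · intro x hx y hy i j hij
    have h1 := hx i j hij
    have h2 := hy i j hij
    simp only [Pi.inf_apply]
    refine le_inf ?_ ?_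
    · linarith [inf_le_left (a := x j) (b := y j)]
    · linarith [inf_le_right (a := x j) (b := y j)]
  · simp only [ofPred_forall]
    refine isClosed_iInter fun i => isClosed_iInter fun j => isClosed_iInter fun _ => ?_
    exact isClosed_le (by fun_prop) (by fun_prop)

theorem two_to_alcoved (C : Set (Fin n → ℝ)) (hne : C.Nonempty)
    (h : TropicalCone C ∧ DualTropicalCone C ∧ IsClosed C) : IsAlcoved C := by
  obtain ⟨⟨hadd, hsup⟩, ⟨-, hinf⟩, hcl⟩ := h
  rw [alcoved_iff]
  refine ⟨fun i j => BddBelow ((fun x : Fin n → ℝ => x i - x j) '' C),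
    fun i j => sInf ((fun x : Fin n → ℝ => x i - x j) '' C), ?_⟩
  apply Subset.antisymm
  · intro x hx i j hij
    have := csInf_le hij (mem_image_of_mem _ hx)
    linarith
  · intro z hz
    rcases Nat.eq_zero_or_pos n with h0 | hpos
    · subst h0
      obtain ⟨c, hc⟩ := hne
      rwa [Subsingleton.elim z c]
    have huniv : (Finset.univ : Finset (Fin n)).Nonempty := ⟨⟨0, hpos⟩, Finset.mem_univ _⟩
    rw [← hcl.closure_eq, Metric.mem_closure_iff]
    intro ε hε
    have key : ∀ i j, ∃ y ∈ C, y i = z i ∧ z j - ε / 2 ≤ y j := by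
      intro i j
      have : ∃ y ∈ C, y i - y j < z i - z j + ε / 2 := by
        by_cases hb : BddBelow ((fun x : Fin n → ℝ => x i - x j) '' C)
        · have h1 := hz i j hb
          obtain ⟨_, ⟨y, hy, rfl⟩, h2⟩ := exists_lt_of_csInf_lt (hne.image _)
            (show sInf ((fun x : Fin n → ℝ => x i - x j) '' C) < z i - z j + ε / 2 by linarith)
          exact ⟨y, hy, h2⟩
        · rw [not_bddBelow_iff] at hb
          obtain ⟨_, ⟨y, hy, rfl⟩, h2⟩ := hb (z i - z j + ε / 2)
          exact ⟨y, hy, h2⟩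
      obtain ⟨y, hy, h1⟩ := this
      refine ⟨_, hadd y hy (z i - y i), ?_, ?_⟩
      · ring
      · linarith
    choose Y hYC hYi hYj using key
    have hV : ∀ i, ∃ v ∈ C, v i = z i ∧ ∀ j, z j - ε / 2 ≤ v j := by
      intro i
      refine ⟨Finset.univ.sup' huniv (Y i), ?_, ?_, ?_⟩
      · exact Finset.sup'_induction huniv _ (fun a ha b hb => hsup a ha b hb)
          (fun j _ => hYC i j)
      · rw [Finset.sup'_apply]
        simp [hYi]
      · intro j
        exact (hYj i j).trans (Finset.le_sup' (Y i) (Finset.mem_univ j) j)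
    choose V hVC hVi hVj using hV
    refine ⟨Finset.univ.inf' huniv V, ?_, ?_⟩
    · exact Finset.inf'_induction huniv _ (fun a ha b hb => hinf a ha b hb) (fun j _ => hVC j)
    · rw [dist_pi_lt_iff hε]
      intro i
      have h1 : (Finset.univ.inf' huniv V) i ≤ z i :=
        (Finset.inf'_le V (Finset.mem_univ i) i).trans (hVi i).le
      have h2 : z i - ε / 2 ≤ (Finset.univ.inf' huniv V) i := by
        rw [Finset.inf'_apply]
        exact Finset.le_inf' _ _ fun k _ => hVj k i
      rw [Real.dist_eq, abs_lt]
      constructor <;> linarith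

theorem alcoved_to_four (C : Set (Fin n → ℝ)) (h : IsAlcoved C) :
    ∃ T : (Fin n → ℝ) → Fin n → ℝ, IsShapley T ∧
      (∀ x y : Fin n → ℝ, T (x ⊔ y) = T x ⊔ T y) ∧ C = {x | T x ≤ x} := by
  classical
  obtain ⟨R, A, rfl⟩ := (alcoved_iff C).1 h
  let g : (Fin n → ℝ) → Fin n → Fin n → ℝ := fun x i j =>
    if R i j then x i ⊔ (A i j + x j) else x i
  let T : (Fin n → ℝ) → Fin n → ℝ := fun x i =>
    Finset.univ.sup' ⟨i, Finset.mem_univ i⟩ (g x i)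
  have hT : ∀ x y : Fin n → ℝ, T (x ⊔ y) = T x ⊔ T y := by
    intro x y
    ext i
    have : g (x ⊔ y) i = g x i ⊔ g y i := by
      ext j
      simp only [g, Pi.sup_apply]
      split_ifs
      · rw [← max_add_add_left]
        exact sup_sup_sup_comm _ _ _ _
      · rfl
    simp only [T, this, Pi.sup_apply]
    apply le_antisymm
    · exact Finset.sup'_le _ _ fun j hj =>
        sup_le_sup (Finset.le_sup' (g x i) hj) (Finset.le_sup' (g y i) hj)
    · exact sup_le
        (Finset.sup'_le _ _ fun j hj => le_sup_left.trans (Finset.le_sup' (g x i ⊔ g y i) hj))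
        (Finset.sup'_le _ _ fun j hj => le_sup_right.trans (Finset.le_sup' (g x i ⊔ g y i) hj))
  refine ⟨T, ⟨?_, ?_⟩, hT, ?_⟩
  · intro x y hxy
    have := hT x y
    rw [sup_eq_right.2 hxy] at this
    rw [this]
    exact le_sup_left
  · intro l x
    ext i
    have hg : ∀ j, g (fun i => l + x i) i j = l + g x i j := by
      intro j
      simp only [g]
      split_ifs
      · rw [← max_add_add_left]
        congr 1
        ring
      · rfl
    apply le_antisymm
    · refine Finset.sup'_le _ _ fun j hj => ?_
      rw [hg]
      have := Finset.le_sup' (g x i) hj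
      show l + g x i j ≤ l + Finset.univ.sup' _ (g x i)
      linarith
    · have : T x i ≤ T (fun i => l + x i) i - l := by
        refine Finset.sup'_le _ _ fun j hj => ?_
        have := Finset.le_sup' (g (fun i => l + x i) i) hj
        rw [hg] at this
        show g x i j ≤ Finset.univ.sup' _ (g (fun i => l + x i) i) - l
        linarith
      linarith
  · ext x
    simp only [mem_ofPred_eq]
    constructor
    · intro hx i
      refine Finset.sup'_le _ _ fun j _ => ?_
      simp only [g]
      split_ifs with hij
      · exact sup_le le_rfl (hx i j hij)
      · exact le_rfl
    · intro hx i j hij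
      have h1 := (Finset.le_sup' (g x i) (Finset.mem_univ j)).trans (hx i)
      simp only [g, hij, if_true] at h1
      exact le_sup_right.trans h1

theorem four_to_two (C : Set (Fin n → ℝ)) (h :
    ∃ T : (Fin n → ℝ) → Fin n → ℝ, IsShapley T ∧
      (∀ x y : Fin n → ℝ, T (x ⊔ y) = T x ⊔ T y) ∧ C = {x | T x ≤ x}) :
    TropicalCone C ∧ DualTropicalCone C ∧ IsClosed C := by
  obtain ⟨T, ⟨hm, ha⟩, hs, rfl⟩ := h
  have hadd : AdditiveCone {x | T x ≤ x} := by
    intro x hx l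
    show T _ ≤ _
    rw [ha]
    intro i
    have := hx i
    simpa using this
  refine ⟨⟨hadd, ?_⟩, ⟨hadd, ?_⟩, ?_⟩
  · intro x hx y hy
    show T _ ≤ _
    rw [hs]
    exact sup_le_sup hx hy
  · intro x hx y hy
    exact le_inf ((hm inf_le_left).trans hx) ((hm inf_le_right).trans hy)
  · refine isClosed_of_closure_subset fun x hx i => ?_
    refine le_of_forall_pos_le_add fun ε hε => ?_
    rw [Metric.mem_closure_iff] at hx
    obtain ⟨y, hy, hd⟩ := hx (ε / 2) (half_pos hε)
    rw [dist_pi_lt_iff (half_pos hε)] at hd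
    have hd' : ∀ k, -(ε / 2) < x k - y k ∧ x k - y k < ε / 2 := fun k => by
      have := hd k
      rwa [Real.dist_eq, abs_lt] at this
    have h1 : x ≤ fun k => ε / 2 + y k := fun k => by
      have := (hd' k).2
      show x k ≤ ε / 2 + y k
      linarith
    have h2 := hm h1 i
    rw [ha] at h2
    have h3 : T y i ≤ y i := hy i
    have h4 := (hd' i).1
    simp only at h2
    linarith

theorem alcoved_neg (C : Set (Fin n → ℝ)) (h : IsAlcoved C) : IsAlcoved {x | -x ∈ C} := by
  rw [alcoved_iff] at h ⊢
  obtain ⟨R, A, rfl⟩ := h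
  refine ⟨fun i j => R j i, fun i j => A j i, ?_⟩
  ext x
  simp only [mem_ofPred_eq, Pi.neg_apply]
  constructor
  · intro h i j hij
    linarith [h j i hij]
  · intro h i j hij
    linarith [h j i hij]

theorem shapley_neg (T : (Fin n → ℝ) → Fin n → ℝ) (h : IsShapley T) :
    IsShapley (fun x => -T (-x)) := by
  refine ⟨fun x y hxy => neg_le_neg (h.1 (neg_le_neg hxy)), fun l x => ?_⟩
  have : (-fun i => l + x i) = fun i => -l + (-x) i := by
    ext i
    simp only [Pi.neg_apply]
    ring
  simp only [this, h.2]
  ext i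
  simp only [Pi.neg_apply]
  ring

theorem alcoved_to_five (C : Set (Fin n → ℝ)) (h : IsAlcoved C) :
    ∃ T : (Fin n → ℝ) → Fin n → ℝ, IsShapley T ∧
      (∀ x y : Fin n → ℝ, T (x ⊓ y) = T x ⊓ T y) ∧ C = {x | x ≤ T x} := by
  obtain ⟨T, hT, hs, hC⟩ := alcoved_to_four _ (alcoved_neg C h)
  refine ⟨_, shapley_neg T hT, ?_, ?_⟩
  · intro x y
    simp only [neg_inf, hs, neg_sup]
  · ext x
    have := Set.ext_iff.1 hC (-x)
    simp only [mem_ofPred_eq, neg_neg] at this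
    rw [this, mem_ofPred_eq, le_neg]

theorem five_to_alcoved (C : Set (Fin n → ℝ)) (hne : C.Nonempty) (h :
    ∃ T : (Fin n → ℝ) → Fin n → ℝ, IsShapley T ∧
      (∀ x y : Fin n → ℝ, T (x ⊓ y) = T x ⊓ T y) ∧ C = {x | x ≤ T x}) : IsAlcoved C := by
  obtain ⟨T, hT, hs, hC⟩ := h
  have h1 : IsAlcoved {x | -x ∈ C} := by
    refine two_to_alcoved _ ?_ (four_to_two _ ⟨_, shapley_neg T hT, ?_, ?_⟩)
    · obtain ⟨c, hc⟩ := hne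
      exact ⟨-c, by simpa using hc⟩
    · intro x y
      simp only [neg_sup, hs, neg_inf]
    · ext x
      simp only [hC, mem_ofPred_eq]
      rw [neg_le]
  have h2 := alcoved_neg _ h1
  simpa using h2

/-- For a nonempty `C ⊆ ℝ^n`, the following are equivalent:
(1) `C` is an alcoved polyhedron;
(2) `C` is both a closed tropical cone and a closed dual tropical cone;
(3) `C` is a closed ambitropical cone whose lattice operations coincide with
the componentwise max and min of `ℝ^n`;
(4) `C = {x ∣ T(x) ≤ x}` for a tropically linear Shapley operator `T`;
(5) `C = {x ∣ T(x) ≥ x}` for a dually tropically linear Shapley operator `T`. -/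
theorem alcoved_characterizations {n : ℕ}
    (C : Set (Fin n → ℝ)) (hne : C.Nonempty) :
    (IsAlcoved C ↔ (TropicalCone C ∧ DualTropicalCone C ∧ IsClosed C)) ∧
    (IsAlcoved C ↔ (IsAmbitropicalCone C ∧ IsClosed C ∧
      ∀ x ∈ C, ∀ y ∈ C,
        IsLubWithin C {x, y} (x ⊔ y) ∧ IsGlbWithin C {x, y} (x ⊓ y))) ∧
    (IsAlcoved C ↔ ∃ T : (Fin n → ℝ) → Fin n → ℝ, IsShapley T ∧
      (∀ x y : Fin n → ℝ, T (x ⊔ y) = T x ⊔ T y) ∧ C = {x | T x ≤ x}) ∧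
    (IsAlcoved C ↔ ∃ T : (Fin n → ℝ) → Fin n → ℝ, IsShapley T ∧
      (∀ x y : Fin n → ℝ, T (x ⊓ y) = T x ⊓ T y) ∧ C = {x | x ≤ T x}) := by
  have h12 : IsAlcoved C ↔ (TropicalCone C ∧ DualTropicalCone C ∧ IsClosed C) :=
    ⟨alcoved_to_two C, two_to_alcoved C hne⟩
  refine ⟨h12, ?_, ⟨alcoved_to_four C, fun h => h12.2 (four_to_two C h)⟩,
    ⟨alcoved_to_five C, five_to_alcoved C hne⟩⟩
  rw [h12]
  constructor
  · rintro ⟨⟨hadd, hsup⟩, ⟨-, hinf⟩, hcl⟩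
    have key : ∀ x ∈ C, ∀ y ∈ C,
        IsLubWithin C {x, y} (x ⊔ y) ∧ IsGlbWithin C {x, y} (x ⊓ y) := by
      intro x hx y hy
      refine ⟨⟨hsup x hx y hy, ?_, fun w _ hw => sup_le (hw x (by simp)) (hw y (by simp))⟩,
        ⟨hinf x hx y hy, ?_, fun w _ hw => le_inf (hw x (by simp)) (hw y (by simp))⟩⟩
      · rintro z (rfl | rfl)
        · exact le_sup_left
        · exact le_sup_right
      · rintro z (rfl | rfl)
        · exact inf_le_left
        · exact inf_le_right
    exact ⟨⟨hne, hadd, fun x hx y hy => ⟨⟨_, (key x hx y hy).1⟩, ⟨_, (key x hx y hy).2⟩⟩⟩,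
      hcl, key⟩
  · rintro ⟨⟨-, hadd, -⟩, hcl, key⟩
    exact ⟨⟨hadd, fun x hx y hy => (key x hx y hy).1.1⟩,
      ⟨hadd, fun x hx y hy => (key x hx y hy).2.1⟩, hcl⟩


end Ambitropical
end

section
/- Let C be a nonempty subset of ℝ^n. The following are equivalent: (1) C is a closed tropical cone; (2) C is a closed ambitropical cone in which the least upper bound operation coincides with the componentwise max of ℝ^n; (3) there is a Shapley operator T : ℝ^n → ℝ^n such that C = {x ∈ ℝ^n : T(x) ≥ x}. -/
open Set Filter Topology

namespace Ambitropical

variable {n : ℕ}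

theorem exists_proj (C : Set (Fin n → ℝ)) (hne : C.Nonempty) (hC : TropicalCone C)
    (hcl : IsClosed C) (x : Fin n → ℝ) :
    ∃ p, p ∈ C ∧ IsLUB {y | y ∈ C ∧ y ≤ x} p := by
  obtain ⟨c, hc⟩ := hne
  have hD : ({y | y ∈ C ∧ y ≤ x}).Nonempty := by
    refine ⟨fun i => -(‖x‖ + ‖c‖) + c i, hC.1 c hc _, fun i => ?_⟩
    have h1 := norm_le_pi_norm x i
    have h2 := norm_le_pi_norm c i
    rw [Real.norm_eq_abs] at h1 h2
    have h3 := neg_abs_le (x i)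
    have h4 := le_abs_self (c i)
    show -(‖x‖ + ‖c‖) + c i ≤ x i
    linarith
  have hex : ∃ p, IsLUB {y | y ∈ C ∧ y ≤ x} p := by
    choose f hf using fun i : Fin n => Real.exists_isLUB
      (s := Function.eval i '' {y | y ∈ C ∧ y ≤ x}) (hD.image _)
      ⟨x i, by rintro _ ⟨y, hy, rfl⟩; exact hy.2 i⟩
    exact ⟨f, isLUB_pi.2 hf⟩
  obtain ⟨p, hp⟩ := hex
  refine ⟨p, ?_, hp⟩
  have hdir : DirectedOn (· ≤ ·) {y | y ∈ C ∧ y ≤ x} := fun a ha b hb =>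
    ⟨a ⊔ b, ⟨hC.2 a ha.1 b hb.1, sup_le ha.2 hb.2⟩, le_sup_left, le_sup_right⟩
  haveI : Nonempty {y | y ∈ C ∧ y ≤ x} := hD.to_subtype
  haveI : IsDirectedOrder {y | y ∈ C ∧ y ≤ x} :=
    ⟨fun a b => by
      obtain ⟨z, hz, h1, h2⟩ := hdir a a.2 b b.2
      exact ⟨⟨z, hz⟩, h1, h2⟩⟩
  have ht : Tendsto (fun y : {y | y ∈ C ∧ y ≤ x} => (y : Fin n → ℝ)) atTop (𝓝 p) :=
    tendsto_atTop_isLUB (fun a b h => h) (by rw [Subtype.range_coe]; exact hp)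
  exact hcl.mem_of_tendsto ht (Eventually.of_forall fun y => y.2.1)

/-- For a nonempty `C ⊆ ℝ^n`, the following are equivalent:
(1) `C` is a closed tropical cone;
(2) `C` is a closed ambitropical cone whose least upper bound operation
coincides with the componentwise max of `ℝ^n`;
(3) `C = {x ∣ T(x) ≥ x}` for some Shapley operator `T`. -/
theorem closed_tropical_cone_characterizations {n : ℕ}
    (C : Set (Fin n → ℝ)) (hne : C.Nonempty) :
    ((TropicalCone C ∧ IsClosed C) ↔
      (IsAmbitropicalCone C ∧ IsClosed C ∧
        ∀ x ∈ C, ∀ y ∈ C, IsLubWithin C {x, y} (x ⊔ y))) ∧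
    ((TropicalCone C ∧ IsClosed C) ↔
      ∃ T : (Fin n → ℝ) → Fin n → ℝ, IsShapley T ∧ C = {x | x ≤ T x}) := by
  refine ⟨⟨fun ⟨hC, hcl⟩ => ?_, fun ⟨hA, hcl, hs⟩ => ?_⟩, ⟨fun ⟨hC, hcl⟩ => ?_, ?_⟩⟩
  · have hs : ∀ x ∈ C, ∀ y ∈ C, IsLubWithin C {x, y} (x ⊔ y) := by
      intro x hx y hy
      refine ⟨hC.2 x hx y hy, ?_, fun w _ h => sup_le (h x (by simp)) (h y (by simp))⟩
      rintro z (rfl | rfl)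
      · exact le_sup_left
      · exact le_sup_right
    refine ⟨⟨hne, hC.1, fun x hx y hy => ⟨⟨_, hs x hx y hy⟩, ?_⟩⟩, hcl, hs⟩
    obtain ⟨p, hpC, hp⟩ := exists_proj C hne hC hcl (x ⊓ y)
    have hle : p ≤ x ⊓ y := hp.2 fun z hz => hz.2
    refine ⟨p, hpC, ?_, fun w hw h => hp.1 ⟨hw, le_inf (h x (by simp)) (h y (by simp))⟩⟩
    rintro z (rfl | rfl)
    · exact hle.trans inf_le_left
    · exact hle.trans inf_le_right
  · exact ⟨⟨hA.2.1, fun x hx y hy => (hs x hx y hy).1⟩, hcl⟩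
  · choose P hPC hP using exists_proj C hne hC hcl
    have hle : ∀ x, P x ≤ x := fun x => (hP x).2 fun z hz => hz.2
    have hadd : ∀ (l : ℝ) x, (fun i => l + P x i) ≤ P (fun i => l + x i) := fun l x =>
      (hP _).1 ⟨hC.1 _ (hPC x) l, fun i => by
        have := hle x i
        show l + P x i ≤ l + x i
        linarith⟩
    refine ⟨P, ⟨fun x y h => (hP y).1 ⟨hPC x, (hle x).trans h⟩, fun l x => ?_⟩, ?_⟩
    · refine le_antisymm (fun i => ?_) (hadd l x)
      have h := hadd (-l) (fun i => l + x i) i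
      simp only [neg_add_cancel_left] at h
      show P (fun i => l + x i) i ≤ l + P x i
      linarith
    · ext x
      refine ⟨fun hx => (hP x).1 ⟨hx, le_rfl⟩, fun hx => ?_⟩
      have : x = P x := le_antisymm hx (hle x)
      rw [this]
      exact hPC x
  · rintro ⟨T, ⟨hm, ha⟩, rfl⟩
    refine ⟨⟨fun x hx l => ?_, fun x hx y hy => ?_⟩, ?_⟩
    · show _ ≤ T _
      rw [ha]
      intro i
      have := hx i
      show l + x i ≤ l + T x i
      linarith
    · exact sup_le (le_trans hx (hm le_sup_left)) (le_trans hy (hm le_sup_right))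
    · refine isClosed_of_closure_subset fun x hx i => ?_
      refine le_of_forall_pos_le_add fun ε hε => ?_
      obtain ⟨y, hy, hd⟩ := Metric.mem_closure_iff.1 hx (ε / 2) (half_pos hε)
      have hd' : ∀ j, |x j - y j| ≤ ε / 2 := fun j => by
        rw [← Real.dist_eq]
        exact (dist_le_pi_dist x y j).trans hd.le
      have h1 : y ≤ fun j => ε / 2 + x j := fun j => by
        have := (abs_le.1 (hd' j)).1
        show y j ≤ ε / 2 + x j
        linarith
      have h2 := hm h1 i
      rw [ha] at h2
      have h3 := hy i
      have h4 := (abs_le.1 (hd' i)).2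
      simp only at h2
      linarith

end Ambitropical
end

section
/- Let C ⊆ ℝ^n. The following are equivalent: (1) C is a closed homogeneous ambitropical cone (i.e., a closed ambitropical cone with αx ∈ C for all α > 0 and x ∈ C); (2) C is the fixed point set of an idempotent homogeneous Shapley operator ℝ^n → ℝ^n; (3) C is the fixed point set of a homogeneous Shapley operator ℝ^n → ℝ^n. -/
open Set Filter Topology

namespace Ambitropical

variable {n : ℕ}

/-- A set closed, downward directed and bounded below has a least element. -/
lemma exists_least_of_directed (U : Set (Fin n → ℝ)) (hU : IsClosed U) (hne : U.Nonempty)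
    (hd : ∀ a ∈ U, ∀ b ∈ U, ∃ c ∈ U, c ≤ a ∧ c ≤ b) (m : Fin n → ℝ) (hm : ∀ a ∈ U, m ≤ a) :
    ∃ z ∈ U, ∀ a ∈ U, z ≤ a := by
  haveI : Nonempty U := hne.to_subtype
  haveI : IsDirected U (fun a b => b ≤ a) := ⟨by
    rintro ⟨a, ha⟩ ⟨b, hb⟩
    obtain ⟨c, hc, h1, h2⟩ := hd a ha b hb
    exact ⟨⟨c, hc⟩, h1, h2⟩⟩
  have hb : ∀ i, BddBelow (Set.range fun a : U => a.1 i) := by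
    intro i
    refine ⟨m i, ?_⟩
    rintro _ ⟨a, rfl⟩
    exact hm a.1 a.2 i
  refine ⟨fun i => ⨅ a : U, a.1 i, ?_, ?_⟩
  · have ht : Tendsto (fun a : U => a.1) atBot (𝓝 (fun i => ⨅ a : U, a.1 i)) := by
      rw [tendsto_pi_nhds]
      intro i
      exact tendsto_atBot_ciInf (fun a b hab => hab i) (hb i)
    exact hU.mem_of_tendsto ht (Eventually.of_forall fun a => a.2)
  · intro a ha i
    exact ciInf_le (hb i) ⟨a, ha⟩

lemma exists_shift_le (x y : Fin n → ℝ) : ∃ l : ℝ, (fun i => l + x i) ≤ y := by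
  refine ⟨-dist x y, fun i => ?_⟩
  have h := dist_le_pi_dist x y i
  rw [Real.dist_eq] at h
  have := (abs_le.1 h).2
  show -dist x y + x i ≤ y i
  linarith

lemma exists_le_shift (x y : Fin n → ℝ) : ∃ l : ℝ, y ≤ (fun i => l + x i) := by
  refine ⟨dist x y, fun i => ?_⟩
  have h := dist_le_pi_dist x y i
  rw [Real.dist_eq] at h
  have := (abs_le.1 h).1
  show y i ≤ dist x y + x i
  linarith

lemma exists_qminus (C : Set (Fin n → ℝ)) (hA : IsAmbitropicalCone C) (hC : IsClosed C) :
    ∃ Q, IsQminusMap C Q := by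
  obtain ⟨⟨p, hp⟩, hadd, hlat⟩ := hA
  have key : ∀ x : Fin n → ℝ, ∃ z, IsLubWithin C {y ∈ C | y ≤ x} z := by
    intro x
    obtain ⟨l, hl⟩ := exists_shift_le p x
    obtain ⟨k, hk⟩ := exists_le_shift p x
    have hcl : IsClosed {w | w ∈ C ∧ ∀ y ∈ {y ∈ C | y ≤ x}, y ≤ w} := by
      have : {w | w ∈ C ∧ ∀ y ∈ {y ∈ C | y ≤ x}, y ≤ w}
          = C ∩ ⋂ y ∈ {y ∈ C | y ≤ x}, Set.Ici y := by
        ext w; simp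
      rw [this]
      exact hC.inter (isClosed_biInter fun y _ => isClosed_Ici)
    obtain ⟨z, ⟨hz, hz'⟩, hmin⟩ := exists_least_of_directed
      {w | w ∈ C ∧ ∀ y ∈ {y ∈ C | y ≤ x}, y ≤ w} hcl
      ⟨_, hadd p hp k, fun y hy => hy.2.trans hk⟩ (by
        rintro a ⟨ha, ha'⟩ b ⟨hb, hb'⟩
        obtain ⟨c, hc, h1, h2⟩ := (hlat a ha b hb).2
        refine ⟨c, ⟨hc, fun y hy => h2 y hy.1 ?_⟩, h1 a (by simp), h1 b (by simp)⟩
        rintro w (rfl | rfl)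
        · exact ha' y hy
        · exact hb' y hy)
      (fun i => l + p i) (fun a ha => ha.2 _ ⟨hadd p hp l, hl⟩)
    exact ⟨z, hz, hz', fun w hw hw' => hmin w ⟨hw, hw'⟩⟩
  choose Q hQ using key
  exact ⟨Q, hQ⟩

lemma one_to_two (C : Set (Fin n → ℝ)) (hA : IsAmbitropicalCone C) (hC : IsClosed C)
    (hH : HomogeneousSet C) : ∃ T : (Fin n → ℝ) → Fin n → ℝ,
        IsShapley T ∧ HomogeneousMap T ∧ T ∘ T = T ∧ {x | T x = x} = C := by
  obtain ⟨Q, hQ⟩ := exists_qminus C hA hC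
  have hadd := hA.2.1
  have hfix : ∀ x ∈ C, Q x = x := fun x hx =>
    le_antisymm ((hQ x).2.2 x hx fun y hy => hy.2) ((hQ x).2.1 x ⟨hx, le_rfl⟩)
  have ha : ∀ (l : ℝ) (x : Fin n → ℝ), Q (fun i => l + x i) ≤ fun i => l + Q x i := by
    intro l x
    refine (hQ _).2.2 _ (hadd _ (hQ x).1 l) ?_
    rintro y ⟨hy, hyx⟩ i
    have h := (hQ x).2.1 (fun i => -l + y i) ⟨hadd y hy (-l), fun j => by
      have := hyx j
      simp only at this ⊢
      linarith⟩ i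
    simp only at h ⊢
    linarith
  have hh : ∀ α : ℝ, 0 < α → ∀ x, Q (α • x) ≤ α • Q x := by
    intro α hα x
    refine (hQ _).2.2 _ (hH α hα _ (hQ x).1) ?_
    rintro y ⟨hy, hyx⟩
    have h := (hQ x).2.1 (α⁻¹ • y) ⟨hH _ (inv_pos.2 hα) y hy, (inv_smul_le_iff_of_pos hα).2 hyx⟩
    exact (inv_smul_le_iff_of_pos hα).1 h
  refine ⟨Q, ⟨?_, ?_⟩, ?_, ?_, ?_⟩
  · intro x x' hx
    exact (hQ x).2.2 _ (hQ x').1 fun y hy => (hQ x').2.1 y ⟨hy.1, hy.2.trans hx⟩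
  · intro l x
    refine le_antisymm (ha l x) fun i => ?_
    have h := ha (-l) (fun i => l + x i) i
    simp only [neg_add_cancel_left] at h ⊢
    linarith
  · intro α hα x
    refine le_antisymm (hh α hα x) ?_
    have h := hh α⁻¹ (inv_pos.2 hα) (α • x)
    rw [inv_smul_smul₀ hα.ne'] at h
    exact (le_inv_smul_iff_of_pos hα).1 h
  · funext x
    exact hfix _ (hQ x).1
  · ext x
    refine ⟨fun h => ?_, hfix x⟩
    rw [← show Q x = x from h]
    exact (hQ x).1

lemma shapley_continuous (T : (Fin n → ℝ) → Fin n → ℝ) (hT : IsShapley T) : Continuous T := by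
  have h1 : ∀ x y i, T x i ≤ dist x y + T y i := by
    intro x y i
    have : x ≤ fun i => dist x y + y i := by
      intro j
      have h := dist_le_pi_dist x y j
      rw [Real.dist_eq] at h
      have := (abs_le.1 h).2
      show x j ≤ dist x y + y j
      linarith
    have h := hT.1 this i
    rwa [hT.2] at h
  refine LipschitzWith.continuous (K := 1) (LipschitzWith.of_dist_le_mul fun x y => ?_)
  rw [NNReal.coe_one, one_mul, dist_pi_le_iff dist_nonneg]
  intro i
  rw [Real.dist_eq, abs_le]
  have h2 := h1 x y i
  have h3 := h1 y x i
  rw [dist_comm] at h3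
  constructor <;> linarith

lemma three_to_one (C : Set (Fin n → ℝ)) (T : (Fin n → ℝ) → Fin n → ℝ) (hT : IsShapley T)
    (hH : HomogeneousMap T) (hC : {x | T x = x} = C) :
    IsAmbitropicalCone C ∧ IsClosed C ∧ HomogeneousSet C := by
  subst hC
  have h0 : T 0 = 0 := by
    have h := hH 2 two_pos 0
    rw [smul_zero] at h
    funext i
    have := congrFun h i
    simp only [Pi.smul_apply, smul_eq_mul, Pi.zero_apply] at this ⊢
    linarith
  have hadd : AdditiveCone {x | T x = x} := by
    intro x hx l
    show T _ = _
    rw [hT.2, show T x = x from hx]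
  refine ⟨⟨⟨0, h0⟩, hadd, fun x hx y hy => ⟨?_, ?_⟩⟩,
    isClosed_eq (shapley_continuous T hT) continuous_id, ?_⟩
  · obtain ⟨l, hl⟩ := exists_le_shift 0 (x ⊔ y)
    have hne : {w | T w ≤ w ∧ x ≤ w ∧ y ≤ w}.Nonempty :=
      ⟨_, (hadd 0 h0 l).le, le_sup_left.trans hl, le_sup_right.trans hl⟩
    have hb : BddBelow {w | T w ≤ w ∧ x ≤ w ∧ y ≤ w} := ⟨x, fun w hw => hw.2.1⟩
    set z := sInf {w | T w ≤ w ∧ x ≤ w ∧ y ≤ w} with hz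
    have hxz : x ≤ z := le_csInf hne fun w hw => hw.2.1
    have hyz : y ≤ z := le_csInf hne fun w hw => hw.2.2
    have h1 : T z ≤ z := le_csInf hne fun w hw => (hT.1 (csInf_le hb hw)).trans hw.1
    have h2 : z ≤ T z := csInf_le hb ⟨hT.1 h1, (show T x = x from hx).ge.trans (hT.1 hxz),
      (show T y = y from hy).ge.trans (hT.1 hyz)⟩
    refine ⟨z, le_antisymm h1 h2, ?_, fun w hw hw' =>
      csInf_le hb ⟨(show T w = w from hw).le, hw' x (by simp), hw' y (by simp)⟩⟩
    rintro w (rfl | rfl)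
    · exact hxz
    · exact hyz
  · obtain ⟨l, hl⟩ := exists_shift_le 0 (x ⊓ y)
    have hne : {w | w ≤ T w ∧ w ≤ x ∧ w ≤ y}.Nonempty :=
      ⟨_, (hadd 0 h0 l).ge, hl.trans inf_le_left, hl.trans inf_le_right⟩
    have hb : BddAbove {w | w ≤ T w ∧ w ≤ x ∧ w ≤ y} := ⟨x, fun w hw => hw.2.1⟩
    set z := sSup {w | w ≤ T w ∧ w ≤ x ∧ w ≤ y} with hz
    have hxz : z ≤ x := csSup_le hne fun w hw => hw.2.1
    have hyz : z ≤ y := csSup_le hne fun w hw => hw.2.2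
    have h1 : z ≤ T z := csSup_le hne fun w hw => hw.1.trans (hT.1 (le_csSup hb hw))
    have h2 : T z ≤ z := le_csSup hb ⟨hT.1 h1, (hT.1 hxz).trans (show T x = x from hx).le,
      (hT.1 hyz).trans (show T y = y from hy).le⟩
    refine ⟨z, le_antisymm h2 h1, ?_, fun w hw hw' =>
      le_csSup hb ⟨(show T w = w from hw).ge, hw' x (by simp), hw' y (by simp)⟩⟩
    rintro w (rfl | rfl)
    · exact hxz
    · exact hyz
  · intro α hα x hx
    show T _ = _
    rw [hH α hα, show T x = x from hx]

/-- For `C ⊆ ℝ^n`, the following are equivalent: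
(1) `C` is a closed homogeneous ambitropical cone;
(2) `C` is the fixed point set of an idempotent homogeneous Shapley operator;
(3) `C` is the fixed point set of a homogeneous Shapley operator. -/
theorem homogeneous_ambitropical_characterizations {n : ℕ}
    (C : Set (Fin n → ℝ)) :
    ((IsAmbitropicalCone C ∧ IsClosed C ∧ HomogeneousSet C) ↔
      ∃ T : (Fin n → ℝ) → Fin n → ℝ,
        IsShapley T ∧ HomogeneousMap T ∧ T ∘ T = T ∧ {x | T x = x} = C) ∧
    ((IsAmbitropicalCone C ∧ IsClosed C ∧ HomogeneousSet C) ↔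
      ∃ T : (Fin n → ℝ) → Fin n → ℝ,
        IsShapley T ∧ HomogeneousMap T ∧ {x | T x = x} = C) := by
  refine ⟨⟨fun h => one_to_two C h.1 h.2.1 h.2.2, ?_⟩, ⟨fun h => ?_, ?_⟩⟩
  · rintro ⟨T, h1, h2, _, h4⟩
    exact three_to_one C T h1 h2 h4
  · obtain ⟨T, h1, h2, _, h4⟩ := one_to_two C h.1 h.2.1 h.2.2
    exact ⟨T, h1, h2, h4⟩
  · rintro ⟨T, h1, h2, h4⟩
    exact three_to_one C T h1 h2 h4

end Ambitropical
end

section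
/- The map C ↦ Sk(C) := C ∩ {0,1}^n is a bijection between the set of homogeneous ambitropical polyhedra of ℝ^n and the set of subsets S of {0,1}^n (viewed inside ℝ^n) that contain the bottom element (0,…,0) and the top element (1,…,1) and are lattices in the induced componentwise order (every two elements of S have a least upper bound and a greatest lower bound within S). -/
open Set Filter Topology

namespace Ambitropical

variable {n : ℕ}

/-- The Boolean hypercube `{0,1}^n`, viewed inside `ℝ^n`. -/
def Cube (n : ℕ) : Set (Fin n → ℝ) := {x | ∀ i, x i = 0 ∨ x i = 1}

/-- A homogeneous ambitropical polyhedron: a homogeneous ambitropical cone that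
is a finite union of alcoved polyhedra. -/
def IsHomogeneousAmbitropicalPolyhedron {n : ℕ} (C : Set (Fin n → ℝ)) : Prop :=
  IsAmbitropicalCone C ∧ HomogeneousSet C ∧
    ∃ (k : ℕ) (F : Fin k → Set (Fin n → ℝ)),
      (∀ i, IsAlcoved (F i)) ∧ C = ⋃ i, F i

/-- A subset of `{0,1}^n` containing bottom and top and forming a lattice in
the induced componentwise order. -/
def IsCubeLattice {n : ℕ} (S : Set (Fin n → ℝ)) : Prop :=
  S ⊆ Cube n ∧ (fun _ => (0 : ℝ)) ∈ S ∧ (fun _ => (1 : ℝ)) ∈ S ∧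
    ∀ x ∈ S, ∀ y ∈ S, (∃ z, IsLubWithin S {x, y} z) ∧ ∃ z, IsGlbWithin S {x, y} z

/-- The set of points all of whose level vectors lie in `S`. -/
def ExtSk {n : ℕ} (S : Set (Fin n → ℝ)) : Set (Fin n → ℝ) :=
  {x | ∀ s ∈ Cube n, (∀ a b, x a ≤ x b → s a ≤ s b) → s ∈ S}

/-- The level vector of `x` at height `t`. -/
noncomputable def lev {n : ℕ} (t : ℝ) (x : Fin n → ℝ) : Fin n → ℝ :=
  fun i => if t ≤ x i then 1 else 0

lemma lev_mem {n : ℕ} {S : Set (Fin n → ℝ)} {x : Fin n → ℝ} (hx : x ∈ ExtSk S) (t : ℝ) :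
    lev t x ∈ S := by
  apply hx
  · intro i
    unfold lev
    split_ifs <;> simp
  · intro a b hab
    unfold lev
    split_ifs <;> first | linarith | norm_num

lemma IsAlcoved.closed {n : ℕ} {C : Set (Fin n → ℝ)} (h : IsAlcoved C) : IsClosed C := by
  obtain ⟨M, rfl⟩ := h
  simp only [setOf_forall]
  refine isClosed_iInter fun i => isClosed_iInter fun j => ?_
  cases hM : M i j with
  | bot => simp
  | coe m =>
    have : {x : Fin n → ℝ | (m : WithBot ℝ) + (x j : WithBot ℝ) ≤ (x i : WithBot ℝ)}
        = {x | m + x j ≤ x i} := by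
      ext x
      simp only [mem_setOf_eq]
      norm_cast
    rw [this]
    exact isClosed_le (by fun_prop) (by fun_prop)

lemma poly_level {n : ℕ} {C : Set (Fin n → ℝ)} (hC : IsHomogeneousAmbitropicalPolyhedron C)
    {x : Fin n → ℝ} (hx : x ∈ C) : x ∈ ExtSk C := by
  obtain ⟨-, hom, k, F, hF, hCF⟩ := hC
  intro s hs hmono
  have hclosed : IsClosed C := by
    rw [hCF]
    exact isClosed_iUnion_of_finite fun i => (hF i).closed
  have hp : ∃ i, ∃ᶠ m : ℕ in atTop, ((m : ℝ) + 1) • x ∈ F i := by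
    by_contra hcon
    push Not at hcon
    have := Filter.eventually_all.2 hcon
    obtain ⟨m, hm⟩ := this.exists
    have h1 : ((m : ℝ) + 1) • x ∈ C := hom _ (by positivity) x hx
    rw [hCF, mem_iUnion] at h1
    obtain ⟨i, hi⟩ := h1
    exact hm i hi
  obtain ⟨i, hi⟩ := hp
  obtain ⟨M, hM⟩ := hF i
  obtain ⟨m0, hm0⟩ := hi.exists
  have hbot : ∀ a b, x a < x b → M a b = ⊥ := by
    intro a b hab
    cases hm : M a b with
    | bot => rfl
    | coe m =>
      exfalso
      obtain ⟨N, hN⟩ := exists_nat_gt (-m / (x b - x a))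
      obtain ⟨q, hq, hqN⟩ := (hi.and_eventually (eventually_ge_atTop N)).exists
      rw [hM] at hq
      have h2 := hq a b
      rw [hm] at h2
      have h3 : m + ((q : ℝ) + 1) * x b ≤ ((q : ℝ) + 1) * x a := by
        simp only [Pi.smul_apply, smul_eq_mul] at h2
        exact_mod_cast h2
      have h4 : 0 < x b - x a := by linarith
      rw [div_lt_iff₀ h4] at hN
      have h5 : (N : ℝ) ≤ q := by exact_mod_cast hqN
      nlinarith
  have hray : ∀ β : ℝ, 0 ≤ β → ((m0 : ℝ) + 1) • x + β • s ∈ C := by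
    intro β hβ
    rw [hCF, mem_iUnion]
    refine ⟨i, ?_⟩
    rw [hM] at hm0 ⊢
    intro a b
    have h1 := hm0 a b
    rcases lt_or_ge (x a) (x b) with hab | hab
    · rw [hbot a b hab]; simp
    · have h2 := hmono b a hab
      cases hm : M a b with
      | bot => simp
      | coe m =>
        rw [hm] at h1
        simp only [Pi.smul_apply, Pi.add_apply, smul_eq_mul] at h1 ⊢
        have h3 : m + ((m0 : ℝ) + 1) * x b ≤ ((m0 : ℝ) + 1) * x a := by exact_mod_cast h1
        have h4 : m + (((m0 : ℝ) + 1) * x b + β * s b) ≤ ((m0 : ℝ) + 1) * x a + β * s a := by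
          nlinarith
        exact_mod_cast h4
  have hlim : Tendsto (fun q : ℕ => (1 / ((q : ℝ) + 1)) • (((m0 : ℝ) + 1) • x) + s) atTop
      (𝓝 s) := by
    have h := (tendsto_one_div_add_atTop_nhds_zero_nat (𝕜 := ℝ)).smul_const
      (((m0 : ℝ) + 1) • x)
    simpa using h.add_const s
  refine hclosed.mem_of_tendsto hlim (Eventually.of_forall fun q => ?_)
  have hq : (0 : ℝ) < (q : ℝ) + 1 := by positivity
  have h := hom (1 / ((q : ℝ) + 1)) (by positivity) _ (hray ((q : ℝ) + 1) hq.le)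
  rw [smul_add, smul_smul (1 / ((q : ℝ) + 1)) ((q : ℝ) + 1) s, one_div_mul_cancel hq.ne',
    one_smul] at h
  exact h

lemma poly_const {n : ℕ} {C : Set (Fin n → ℝ)} (hC : IsHomogeneousAmbitropicalPolyhedron C)
    (c : ℝ) : (fun _ => c) ∈ C := by
  obtain ⟨x, hx⟩ := hC.1.1
  have h0 : (fun _ => (0 : ℝ)) ∈ C :=
    poly_level hC hx _ (fun i => Or.inl rfl) (fun a b _ => le_rfl)
  simpa using hC.1.2.1 _ h0 c

lemma poly_of_level {n : ℕ} {C : Set (Fin n → ℝ)}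
    (hC : IsHomogeneousAmbitropicalPolyhedron C)
    {x : Fin n → ℝ} (hx : x ∈ ExtSk C) : x ∈ C := by
  obtain ⟨b, hb⟩ : ∃ b, ∀ i, b < x i := by
    obtain ⟨b, hb⟩ := (Set.finite_range x).bddBelow
    exact ⟨b - 1, fun i => by linarith [hb (mem_range_self i)]⟩
  obtain ⟨T, hT⟩ : ∃ b, ∀ i, x i < b := by
    obtain ⟨b, hb⟩ := (Set.finite_range x).bddAbove
    exact ⟨b + 1, fun i => by linarith [hb (mem_range_self i)]⟩
  have hm : ∀ k, (fun i => if x k ≤ x i then x k else b) ∈ C := by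
    intro k
    have h1 : (fun i => if x k ≤ x i then (1 : ℝ) else 0) ∈ C := by
      apply hx
      · intro i
        dsimp only
        split_ifs <;> simp
      · intro i j hij
        try dsimp only
        split_ifs <;> first | linarith | norm_num
    have h2 := hC.1.2.1 _ (hC.2.1 (x k - b) (by linarith [hb k]) _ h1) b
    convert h2 using 1
    ext i
    simp only [Pi.smul_apply, smul_eq_mul]
    split_ifs <;> ring
  have hM : ∀ k, (fun i => if x k < x i then T else x k) ∈ C := by
    intro k
    have h1 : (fun i => if x k < x i then (1 : ℝ) else 0) ∈ C := by
      apply hx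
      · intro i
        dsimp only
        split_ifs <;> simp
      · intro i j hij
        try dsimp only
        split_ifs <;> first | linarith | norm_num
    have h2 := hC.1.2.1 _ (hC.2.1 (T - x k) (by linarith [hT k]) _ h1) (x k)
    convert h2 using 1
    ext i
    simp only [Pi.smul_apply, smul_eq_mul]
    split_ifs <;> ring
  have key : ∀ s : Finset (Fin n), ∃ z ∈ C,
      (∀ k ∈ s, (fun i => if x k ≤ x i then x k else b) ≤ z) ∧
      ∀ k, z ≤ (fun i => if x k < x i then T else x k) := by
    intro s
    induction s using Finset.induction_on with
    | empty =>
      refine ⟨fun _ => b, poly_const hC b, by simp, fun k i => ?_⟩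
      dsimp only
      split_ifs
      · linarith [hb k, hT k]
      · exact (hb k).le
    | insert k s hk ih =>
      obtain ⟨z, hz, h1, h2⟩ := ih
      obtain ⟨w, hw, hw1, hw2⟩ := (hC.1.2.2 z hz _ (hm k)).1
      have hzw : z ≤ w := hw1 _ (by simp)
      refine ⟨w, hw, ?_, ?_⟩
      · intro j hj
        rcases Finset.mem_insert.1 hj with rfl | hj
        · exact hw1 _ (by simp)
        · exact (h1 j hj).trans hzw
      · intro j
        apply hw2 _ (hM j)
        intro y hy
        rcases hy with rfl | rfl
        · exact h2 j
        · intro i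
          dsimp only
          split_ifs <;> linarith [hb i, hb j, hb k, hT i, hT j, hT k]
  obtain ⟨z, hz, h1, h2⟩ := key Finset.univ
  have : z = x := by
    ext k
    have a1 := h1 k (Finset.mem_univ k) k
    have a2 := h2 k k
    simp only [le_refl, lt_irrefl, if_true, if_false] at a1 a2
    exact le_antisymm a2 a1
  exact this ▸ hz

lemma ext_inter {n : ℕ} {C : Set (Fin n → ℝ)}
    (hC : IsHomogeneousAmbitropicalPolyhedron C) : ExtSk (C ∩ Cube n) = C := by
  apply Subset.antisymm
  · intro x hx
    exact poly_of_level hC fun s hs hm => (hx s hs hm).1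
  · intro x hx s hs hm
    exact ⟨poly_level hC hx s hs hm, hs⟩

lemma sk_lattice {n : ℕ} {C : Set (Fin n → ℝ)}
    (hC : IsHomogeneousAmbitropicalPolyhedron C) : IsCubeLattice (C ∩ Cube n) := by
  refine ⟨inter_subset_right, ⟨poly_const hC 0, fun _ => Or.inl rfl⟩,
    ⟨poly_const hC 1, fun _ => Or.inr rfl⟩, ?_⟩
  have c0 : ∀ x ∈ Cube n, (fun _ => (0 : ℝ)) ≤ x := by
    intro x hx i
    rcases hx i with h | h <;> rw [h] <;> norm_num
  have c1 : ∀ x ∈ Cube n, x ≤ (fun _ => (1 : ℝ)) := by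
    intro x hx i
    rcases hx i with h | h <;> rw [h] <;> norm_num
  rintro x ⟨hx, hxc⟩ y ⟨hy, hyc⟩
  constructor
  · obtain ⟨z, hz, hz1, hz2⟩ := (hC.1.2.2 x hx y hy).1
    refine ⟨z, ⟨hz, ?_⟩, hz1, fun w hw => hz2 w hw.1⟩
    have hxz : x ≤ z := hz1 x (by simp)
    have hyz : y ≤ z := hz1 y (by simp)
    have hzl : z ≤ lev 1 z := by
      apply hz2 _ (lev_mem (poly_level hC hz) 1)
      intro u hu i
      have huz := hz1 u hu i
      have huc : u ∈ Cube n := by rcases hu with rfl | rfl <;> assumption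
      unfold lev
      rcases huc i with h | h <;> split_ifs <;> linarith
    intro i
    have h1 := hzl i
    have h2 := c0 x hxc i
    have h3 := hxz i
    unfold lev at h1
    dsimp only at h1 h2
    split_ifs at h1 with h
    · right; linarith
    · left; linarith
  · obtain ⟨z, hz, hz1, hz2⟩ := (hC.1.2.2 x hx y hy).2
    refine ⟨z, ⟨hz, ?_⟩, hz1, fun w hw => hz2 w hw.1⟩
    have hxz : z ≤ x := hz1 x (by simp)
    have h0z : (fun _ => (0 : ℝ)) ≤ z := by
      apply hz2 _ (poly_const hC 0)
      intro u hu
      rcases hu with rfl | rfl <;> apply c0 <;> assumption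
    have hlz : (fun i => if 0 < z i then (1 : ℝ) else 0) ≤ z := by
      apply hz2
      · apply poly_level hC hz
        · intro i
          dsimp only
          split_ifs <;> simp
        · intro i j hij
          try dsimp only
          split_ifs <;> first | linarith | norm_num
      · intro u hu i
        have huz := hz1 u hu i
        have huc : u ∈ Cube n := by rcases hu with rfl | rfl <;> assumption
        dsimp only
        rcases huc i with h | h <;> split_ifs <;> linarith
    intro i
    have h1 := hlz i
    have h2 := c1 x hxc i
    have h3 := hxz i
    have h4 := h0z i
    dsimp only at h1 h2 h4
    split_ifs at h1 with h
    · right; linarith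
    · left; linarith

lemma exists_height (P : ℝ → Prop) (V : Finset ℝ) (hanti : ∀ s t, s ≤ t → P t → P s)
    (h0 : ∃ v ∈ V, P v) (h1 : ∀ t, P t → ∃ v ∈ V, t ≤ v ∧ P v) :
    ∃ z : ℝ, ∀ t, t ≤ z ↔ P t := by
  classical
  obtain ⟨v0, hv0, hP0⟩ := h0
  have hne : (V.filter P).Nonempty := ⟨v0, by simp [hv0, hP0]⟩
  refine ⟨(V.filter P).max' hne, fun t => ⟨fun h => ?_, fun h => ?_⟩⟩
  · have := Finset.max'_mem _ hne
    exact hanti _ _ h (Finset.mem_filter.1 this).2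
  · obtain ⟨v, hv, htv, hPv⟩ := h1 t h
    exact htv.trans (Finset.le_max' _ _ (by simp [hv, hPv]))

lemma mem_ext_of_lev {n : ℕ} {S : Set (Fin n → ℝ)} (h0 : (fun _ => (0 : ℝ)) ∈ S)
    {z : Fin n → ℝ} (hz : ∀ t, lev t z ∈ S) : z ∈ ExtSk S := by
  classical
  intro s hs hm
  by_cases hne : (Finset.univ.filter fun i => s i = 1).Nonempty
  · obtain ⟨k, hk, hmin⟩ := Finset.exists_min_image _ z hne
    simp only [Finset.mem_filter, Finset.mem_univ, true_and] at hk hmin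
    have : s = lev (z k) z := by
      ext i
      unfold lev
      split_ifs with h
      · have := hm k i h
        rcases hs i with h' | h' <;> linarith
      · rcases hs i with h' | h'
        · exact h'
        · exact absurd (hmin i h') h
    rw [this]
    exact hz _
  · have : s = fun _ => 0 := by
      ext i
      rcases hs i with h | h
      · exact h
      · exact absurd ⟨i, by simp [h]⟩ hne
    rw [this]
    exact h0

lemma lev_anti {n : ℕ} {x : Fin n → ℝ} {s t : ℝ} (h : s ≤ t) : lev t x ≤ lev s x := by
  intro i
  unfold lev
  split_ifs <;> first | linarith | norm_num

lemma build {n : ℕ} {S : Set (Fin n → ℝ)} (hS : S ⊆ Cube n) (h0 : (fun _ => (0 : ℝ)) ∈ S)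
    (op : (Fin n → ℝ) → (Fin n → ℝ) → (Fin n → ℝ))
    (hop : ∀ x ∈ S, ∀ y ∈ S, op x y ∈ S)
    (mono : ∀ x ∈ S, ∀ x' ∈ S, ∀ y ∈ S, ∀ y' ∈ S, x ≤ x' → y ≤ y' → op x y ≤ op x' y')
    (op0 : op (fun _ => 0) (fun _ => 0) ≤ fun _ => 0)
    (op1 : (fun _ => 1) ≤ op (fun _ => 1) (fun _ => 1))
    {x y : Fin n → ℝ} (hx : x ∈ ExtSk S) (hy : y ∈ ExtSk S) :
    ∃ z ∈ ExtSk S, ∀ i t, t ≤ z i ↔ op (lev t x) (lev t y) i = 1 := by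
  classical
  have hU : ∀ t, op (lev t x) (lev t y) ∈ S := fun t => hop _ (lev_mem hx t) _ (lev_mem hy t)
  let V : Finset ℝ := Finset.univ.image x ∪ Finset.univ.image y
  have hxV : ∀ i, x i ∈ V := fun i => by simp [V]
  have hyV : ∀ i, y i ∈ V := fun i => by simp [V]
  have key : ∀ i, ∃ z : ℝ, ∀ t, t ≤ z ↔ op (lev t x) (lev t y) i = 1 := by
    intro i
    have hVne : V.Nonempty := ⟨x i, hxV i⟩
    apply exists_height _ V
    · intro s t hst ht
      have h := mono _ (lev_mem hx t) _ (lev_mem hx s) _ (lev_mem hy t) _ (lev_mem hy s)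
        (lev_anti hst) (lev_anti hst) i
      rcases hS (hU s) i with h' | h'
      · linarith
      · exact h'
    · refine ⟨V.min' hVne, Finset.min'_mem _ _, ?_⟩
      have e1 : lev (V.min' hVne) x = fun _ => 1 := by
        ext j; exact if_pos (Finset.min'_le _ _ (hxV j))
      have e2 : lev (V.min' hVne) y = fun _ => 1 := by
        ext j; exact if_pos (Finset.min'_le _ _ (hyV j))
      have h := op1 i
      have h' := hS (hU (V.min' hVne)) i
      rw [e1, e2] at h' ⊢
      dsimp only at h
      rcases h' with h' | h'
      · linarith
      · exact h'
    · intro t ht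
      by_cases hne : (V.filter fun v => t ≤ v).Nonempty
      · have hmem := Finset.min'_mem _ hne
        have hle := fun v hv => Finset.min'_le (V.filter fun v => t ≤ v) v hv
        set v := (V.filter fun v => t ≤ v).min' hne
        rw [Finset.mem_filter] at hmem
        refine ⟨v, hmem.1, hmem.2, ?_⟩
        have e : ∀ u : Fin n → ℝ, (∀ j, u j ∈ V) → lev v u = lev t u := by
          intro u hu
          ext j
          have : v ≤ u j ↔ t ≤ u j :=
            ⟨fun h => hmem.2.trans h, fun h => hle _ (by simp [hu j, h])⟩
          unfold lev
          simp only [this]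
        rw [e x hxV, e y hyV]
        exact ht
      · exfalso
        have e : ∀ u : Fin n → ℝ, (∀ j, u j ∈ V) → lev t u = fun _ => 0 := by
          intro u hu
          ext j
          exact if_neg fun h => hne ⟨u j, by simp [hu j, h]⟩
        rw [e x hxV, e y hyV] at ht
        have := op0 i
        dsimp only at this
        linarith
  choose z hz using key
  refine ⟨z, mem_ext_of_lev h0 fun t => ?_, hz⟩
  have : lev t z = op (lev t x) (lev t y) := by
    ext i
    unfold lev
    split_ifs with h
    · exact ((hz i t).1 h).symm
    · rcases hS (hU t) i with h' | h'
      · exact h'.symm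
      · exact absurd ((hz i t).2 h') h
  rw [this]
  exact hU t

lemma lev_eq_one {n : ℕ} {x : Fin n → ℝ} {t : ℝ} {i : Fin n} : lev t x i = 1 ↔ t ≤ x i := by
  unfold lev
  split_ifs with h <;> simp [h]

lemma lev_mono {n : ℕ} {x y : Fin n → ℝ} (h : x ≤ y) (t : ℝ) : lev t x ≤ lev t y := by
  intro i
  have := h i
  unfold lev
  split_ifs <;> first | linarith | norm_num

lemma one_of_le {n : ℕ} {S : Set (Fin n → ℝ)} (hS : S ⊆ Cube n) {u v : Fin n → ℝ}
    (hv : v ∈ S) (h : u ≤ v) {i : Fin n} (hu : u i = 1) : v i = 1 := by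
  have := h i
  rcases hS hv i with h' | h'
  · linarith
  · exact h'

lemma ext_lattice {n : ℕ} {S : Set (Fin n → ℝ)} (h : IsCubeLattice S) {x y : Fin n → ℝ}
    (hx : x ∈ ExtSk S) (hy : y ∈ ExtSk S) :
    (∃ z, IsLubWithin (ExtSk S) {x, y} z) ∧ ∃ z, IsGlbWithin (ExtSk S) {x, y} z := by
  classical
  obtain ⟨hS, h0, h1, hlat⟩ := h
  constructor
  · have hex : ∀ u v, ∃ z, u ∈ S → v ∈ S → IsLubWithin S {u, v} z := by
      intro u v
      by_cases hu : u ∈ S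
      · by_cases hv : v ∈ S
        · obtain ⟨z, hz⟩ := (hlat u hu v hv).1
          exact ⟨z, fun _ _ => hz⟩
        · exact ⟨u, fun _ h => absurd h hv⟩
      · exact ⟨u, fun h => absurd h hu⟩
    choose op hop using hex
    have hl : ∀ u ∈ S, ∀ v ∈ S, u ≤ op u v := fun u hu v hv => (hop u v hu hv).2.1 u (by simp)
    have hr : ∀ u ∈ S, ∀ v ∈ S, v ≤ op u v := fun u hu v hv => (hop u v hu hv).2.1 v (by simp)
    have hle : ∀ u ∈ S, ∀ v ∈ S, ∀ w ∈ S, u ≤ w → v ≤ w → op u v ≤ w := by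
      intro u hu v hv w hw h1 h2
      apply (hop u v hu hv).2.2 w hw
      rintro a (rfl | rfl) <;> assumption
    have hm : ∀ u ∈ S, ∀ v ∈ S, op u v ∈ S := fun u hu v hv => (hop u v hu hv).1
    obtain ⟨z, hz, hzU⟩ := build hS h0 op hm
      (fun u hu u' hu' v hv v' hv' a b => hle _ hu _ hv _ (hm _ hu' _ hv')
        (a.trans (hl _ hu' _ hv')) (b.trans (hr _ hu' _ hv')))
      (hle _ h0 _ h0 _ h0 le_rfl le_rfl) (hl _ h1 _ h1) hx hy
    refine ⟨z, hz, ?_, ?_⟩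
    · rintro a (rfl | rfl) i
      · exact (hzU i _).2 (one_of_le hS (hm _ (lev_mem hx _) _ (lev_mem hy _))
          (hl _ (lev_mem hx _) _ (lev_mem hy _)) (lev_eq_one.2 le_rfl))
      · exact (hzU i _).2 (one_of_le hS (hm _ (lev_mem hx _) _ (lev_mem hy _))
          (hr _ (lev_mem hx _) _ (lev_mem hy _)) (lev_eq_one.2 le_rfl))
    · intro w hw hub i
      have hxw : x ≤ w := hub x (by simp)
      have hyw : y ≤ w := hub y (by simp)
      exact lev_eq_one.1 (one_of_le hS (lev_mem hw (z i))
        (hle _ (lev_mem hx _) _ (lev_mem hy _) _ (lev_mem hw _) (lev_mono hxw _)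
          (lev_mono hyw _)) ((hzU i _).1 le_rfl))
  · have hex : ∀ u v, ∃ z, u ∈ S → v ∈ S → IsGlbWithin S {u, v} z := by
      intro u v
      by_cases hu : u ∈ S
      · by_cases hv : v ∈ S
        · obtain ⟨z, hz⟩ := (hlat u hu v hv).2
          exact ⟨z, fun _ _ => hz⟩
        · exact ⟨u, fun _ h => absurd h hv⟩
      · exact ⟨u, fun h => absurd h hu⟩
    choose op hop using hex
    have hl : ∀ u ∈ S, ∀ v ∈ S, op u v ≤ u := fun u hu v hv => (hop u v hu hv).2.1 u (by simp)
    have hr : ∀ u ∈ S, ∀ v ∈ S, op u v ≤ v := fun u hu v hv => (hop u v hu hv).2.1 v (by simp)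
    have hle : ∀ u ∈ S, ∀ v ∈ S, ∀ w ∈ S, w ≤ u → w ≤ v → w ≤ op u v := by
      intro u hu v hv w hw h1 h2
      apply (hop u v hu hv).2.2 w hw
      rintro a (rfl | rfl) <;> assumption
    have hm : ∀ u ∈ S, ∀ v ∈ S, op u v ∈ S := fun u hu v hv => (hop u v hu hv).1
    obtain ⟨z, hz, hzU⟩ := build hS h0 op hm
      (fun u hu u' hu' v hv v' hv' a b => hle _ hu' _ hv' _ (hm _ hu _ hv)
        ((hl _ hu _ hv).trans a) ((hr _ hu _ hv).trans b))
      (hl _ h0 _ h0) (hle _ h1 _ h1 _ h1 le_rfl le_rfl) hx hy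
    refine ⟨z, hz, ?_, ?_⟩
    · rintro a (rfl | rfl) i
      · exact lev_eq_one.1 (one_of_le hS (lev_mem hx (z i))
          (hl _ (lev_mem hx _) _ (lev_mem hy _)) ((hzU i _).1 le_rfl))
      · exact lev_eq_one.1 (one_of_le hS (lev_mem hy (z i))
          (hr _ (lev_mem hx _) _ (lev_mem hy _)) ((hzU i _).1 le_rfl))
    · intro w hw hub i
      have hxw : w ≤ x := hub x (by simp)
      have hyw : w ≤ y := hub y (by simp)
      exact (hzU i _).2 (one_of_le hS (hm _ (lev_mem hx _) _ (lev_mem hy _))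
        (hle _ (lev_mem hx _) _ (lev_mem hy _) _ (lev_mem hw (w i)) (lev_mono hxw _)
          (lev_mono hyw _)) (lev_eq_one.2 le_rfl))

lemma ext_poly {n : ℕ} {S : Set (Fin n → ℝ)} (h : IsCubeLattice S) :
    IsHomogeneousAmbitropicalPolyhedron (ExtSk S) := by
  classical
  have hS := h.1
  have h0 := h.2.1
  have h1 := h.2.2.1
  refine ⟨⟨⟨fun _ => 0, mem_ext_of_lev h0 fun t => ?_⟩, ?_,
    fun x hx y hy => ext_lattice h hx hy⟩, ?_, ?_⟩
  · by_cases ht : t ≤ 0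
    · have : lev t (fun _ : Fin n => (0 : ℝ)) = fun _ => 1 := by ext i; exact if_pos ht
      rw [this]; exact h1
    · have : lev t (fun _ : Fin n => (0 : ℝ)) = fun _ => 0 := by ext i; exact if_neg ht
      rw [this]; exact h0
  · intro x hx l s hs hm
    exact hx s hs fun a b hab => hm a b (by dsimp only; linarith)
  · intro α hα x hx s hs hm
    exact hx s hs fun a b hab => hm a b (mul_le_mul_of_nonneg_left hab hα.le)
  · let R := {r : Fin n → Fin n → Prop // ∃ x ∈ ExtSk S, r = fun a b => x a ≤ x b}
    haveI : Finite R := inferInstance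
    obtain ⟨k, ⟨e⟩⟩ := Finite.exists_equiv_fin R
    refine ⟨k, fun i => {y | ∀ a b, (e.symm i).1 a b → y a ≤ y b}, ?_, ?_⟩
    · intro i
      refine ⟨fun a b => if (e.symm i).1 b a then ((0 : ℝ) : WithBot ℝ) else ⊥, ?_⟩
      ext y
      simp only [mem_setOf_eq]
      constructor
      · intro hy a b
        split_ifs with hr
        · have := hy b a hr
          have h' : (0 : ℝ) + y b ≤ y a := by linarith
          exact_mod_cast h'
        · simp
      · intro hy a b hr
        have := hy b a
        rw [if_pos hr] at this
        have h' : (0 : ℝ) + y a ≤ y b := by exact_mod_cast this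
        linarith
    · ext y
      simp only [mem_iUnion, mem_setOf_eq]
      constructor
      · intro hy
        refine ⟨e ⟨fun a b => y a ≤ y b, y, hy, rfl⟩, ?_⟩
        intro a b
        simp
      · rintro ⟨i, hi⟩ s hs hm
        obtain ⟨x, hx, hr⟩ := (e.symm i).2
        refine hx s hs fun a b hab => hm a b (hi a b ?_)
        rw [hr]
        exact hab

lemma ext_cube {n : ℕ} {S : Set (Fin n → ℝ)} (h : IsCubeLattice S) :
    ExtSk S ∩ Cube n = S := by
  apply Subset.antisymm
  · rintro x ⟨hx, hc⟩
    exact hx x hc fun _ _ h => h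
  · intro x hx
    have hc := h.1 hx
    refine ⟨mem_ext_of_lev h.2.1 fun t => ?_, hc⟩
    by_cases ht0 : t ≤ 0
    · have : lev t x = fun _ => 1 := by
        ext i
        refine if_pos ?_
        rcases hc i with h | h <;> linarith
      rw [this]; exact h.2.2.1
    · by_cases ht1 : t ≤ 1
      · have : lev t x = x := by
          ext i
          unfold lev
          rcases hc i with h | h <;> rw [h] <;> simp [ht0, ht1]
        rw [this]; exact hx
      · have : lev t x = fun _ => 0 := by
          ext i
          refine if_neg ?_
          rcases hc i with h | h <;> rw [h] <;> assumption
        rw [this]; exact h.2.1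

/-- The skeleton map `C ↦ C ∩ {0,1}^n` is a bijection between
homogeneous ambitropical polyhedra of `ℝ^n` and subsets of `{0,1}^n` containing
the bottom and top elements that are lattices in the induced order. -/
theorem skeleton_bijection (n : ℕ) :
    Set.BijOn (fun C : Set (Fin n → ℝ) => C ∩ Cube n)
      {C | IsHomogeneousAmbitropicalPolyhedron C}
      {S | IsCubeLattice S} := by
  refine ⟨fun C hC => sk_lattice hC, ?_, ?_⟩
  · intro C hC D hD hCD
    have h : C ∩ Cube n = D ∩ Cube n := hCD
    rw [← ext_inter hC, ← ext_inter hD, h]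
  · intro S hS
    exact ⟨ExtSk S, ext_poly hS, ext_cube hS⟩

end Ambitropical
end
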